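/- (Asymptotic Poisson–Gamma duality) Let φ : [0,∞) → ℝ be a function, three times differentiable on (x₀, ∞) for some x₀ ≥ 0, with φ(0) = 0, such that φ′(x) → 0, x·φ″(x) → 0 and x²·φ‴(x) → 0 as x → ∞. Set ξ(x) = e^{−φ(x)} (so ξ(0) = 1), and suppose the series A(t) = Σ_{n=0}^∞ (t^n/n!) ξ(n) converges for all t ≥ 0 and that the integrals below are finite. Then the combined Gamma-average of the reciprocal Poisson-average of ξ tends to 1: I_m := ∫₀^∞ ((t^m/m!) ξ(m)) / (Σ_{n=0}^∞ (t^n/n!) ξ(n)) dt → 1 as m → ∞. -/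

import Mathlib

open MeasureTheory Filter Set Topology

/-- The probability that a Poisson variable of mean `x` equals `n`; also the density at `x` of the
Gamma distribution with shape `n + 1`. -/
noncomputable def poissonWeight (n : ℕ) (x : ℝ) : ℝ := x ^ n / (n.factorial : ℝ) * Real.exp (-x)

/-- The relative entropy of a Poisson law of mean `y` with respect to one of mean `x`. -/
noncomputable def poissonDev (y x : ℝ) : ℝ := y * Real.log (y / x) - y + x

/-- The remainder at `y` of the first-order Taylor expansion of `φ` at `x`, where `φ'` stands for
the derivative of `φ`. -/
def taylorRem (φ φ' : ℝ → ℝ) (y x : ℝ) : ℝ := φ y - φ x - (y - x) * φ' x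

lemma poissonWeight_nonneg (n : ℕ) {x : ℝ} (hx : 0 ≤ x) : 0 ≤ poissonWeight n x := by
  unfold poissonWeight; positivity

lemma sq_sqrt_sub_sqrt_le_poissonDev {x y : ℝ} (hx : 0 < x) (hy : 0 < y) :
    (√y - √x) ^ 2 ≤ poissonDev y x := by
  have hsx := Real.sqrt_pos.2 hx
  have hsy := Real.sqrt_pos.2 hy
  have hl : Real.log (y / x) = -(2 * Real.log (√x / √y)) := by
    rw [Real.log_div hy.ne' hx.ne', Real.log_div hsx.ne' hsy.ne', Real.log_sqrt hx.le,
      Real.log_sqrt hy.le]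
    ring
  have h1 := Real.log_le_sub_one_of_pos (div_pos hsx hsy)
  have h2 : y * Real.log (√x / √y) ≤ √x * √y - y := by
    calc _ ≤ y * (√x / √y - 1) := by gcongr
      _ = _ := by
        have : y = √y * √y := (Real.mul_self_sqrt hy.le).symm
        rw [this]
        simp only [Real.sqrt_mul_self hsy.le]
        field_simp
  unfold poissonDev
  rw [hl]
  nlinarith [Real.sq_sqrt hx.le, Real.sq_sqrt hy.le]

lemma poissonWeight_mul_exp_poissonDev_half_le {n : ℕ} (hn : 0 < n) {x : ℝ} (hx : 0 < x) :
    poissonWeight n x * Real.exp (poissonDev n x / 2) ≤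
      Real.exp (-(√n - √x) ^ 2 / 2) / (2 * √n) := by
  have hn' : (0 : ℝ) < n := by exact_mod_cast hn
  have hD := sq_sqrt_sub_sqrt_le_poissonDev hx hn'
  have h1 : poissonWeight n x * Real.exp (poissonDev n x) =
      (n / Real.exp 1) ^ n / (n.factorial : ℝ) := by
    have : Real.exp (poissonDev n x) = (n / x) ^ n * (Real.exp 1 ^ n)⁻¹ * Real.exp x := by
      rw [← Real.exp_nat_mul, ← Real.exp_neg, poissonDev, Real.exp_add, sub_eq_add_neg,
        Real.exp_add, Real.exp_nat_mul, Real.exp_log (by positivity), mul_one]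
    rw [this, poissonWeight, Real.exp_neg, div_pow, div_pow]
    field_simp
  have h2 : (n / Real.exp 1) ^ n / (n.factorial : ℝ) ≤ 1 / (2 * √n) := by
    rw [div_le_div_iff₀ (by positivity) (by positivity), one_mul]
    refine le_trans ?_ (Stirling.le_factorial_stirling n)
    rw [mul_comm]
    gcongr
    rw [show (2 : ℝ) * √n = √(4 * n) by
      rw [Real.sqrt_mul (by norm_num), show (4 : ℝ) = 2 ^ 2 by norm_num,
        Real.sqrt_sq (by norm_num)]]
    apply Real.sqrt_le_sqrt
    nlinarith [Real.pi_gt_three]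
  calc poissonWeight n x * Real.exp (poissonDev n x / 2)
      = poissonWeight n x * Real.exp (poissonDev n x) * Real.exp (-poissonDev n x / 2) := by
        rw [mul_assoc, ← Real.exp_add]; ring_nf
    _ ≤ 1 / (2 * √n) * Real.exp (-(√n - √x) ^ 2 / 2) := by
        rw [h1]
        gcongr
    _ = _ := by ring

lemma poissonWeight_succ_mul_exp_le_arctan_sub (n : ℕ) {x : ℝ} (hx : 0 < x) :
    poissonWeight (n + 1) x * Real.exp (poissonDev ((n + 1 : ℕ) : ℝ) x / 2) ≤
      4 * (Real.arctan (√((n + 1 : ℕ) : ℝ) - √x) - Real.arctan (√(n : ℝ) - √x)) := by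
  refine (poissonWeight_mul_exp_poissonDev_half_le n.succ_pos hx).trans ?_
  set s := √((n + 1 : ℕ) : ℝ) with hs
  set r := √(n : ℝ) with hr
  have hs2 : s ^ 2 = r ^ 2 + 1 := by
    rw [hs, hr, Real.sq_sqrt (by positivity), Real.sq_sqrt (by positivity)]; push_cast; ring
  have hr0 : 0 ≤ r := Real.sqrt_nonneg _
  have hs0 : 0 < s := Real.sqrt_pos.2 (by positivity)
  have hrs : r < s := by nlinarith
  have hsr1 : s - r ≤ 1 := by nlinarith
  have hgap : 1 / (2 * s) ≤ s - r := by
    rw [div_le_iff₀ (by positivity)]; nlinarith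
  set a := √x
  obtain ⟨c, hc, hceq⟩ := exists_hasDerivAt_eq_slope (fun y => Real.arctan (y - a))
    (fun y => 1 / (1 + (y - a) ^ 2)) hrs
    (by fun_prop)
    (fun y _ => by simpa using (HasDerivAt.arctan ((hasDerivAt_id y).sub_const a)))
  rw [eq_div_iff (sub_pos.2 hrs).ne'] at hceq
  rw [← hceq]
  have hexp := Real.add_one_le_exp ((s - a) ^ 2 / 2)
  have hca : 1 + (c - a) ^ 2 ≤ 4 * Real.exp ((s - a) ^ 2 / 2) := by
    have : (c - s) ^ 2 ≤ 1 := by nlinarith [hc.1, hc.2]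
    nlinarith [sq_nonneg ((c - s) - (s - a))]
  have : Real.exp (-(s - a) ^ 2 / 2) ≤ 4 * (1 / (1 + (c - a) ^ 2)) := by
    rw [neg_div, Real.exp_neg, mul_one_div, inv_eq_one_div,
      div_le_div_iff₀ (by positivity) (by positivity)]
    linarith
  calc Real.exp (-(s - a) ^ 2 / 2) / (2 * s)
      = Real.exp (-(s - a) ^ 2 / 2) * (1 / (2 * s)) := by ring
    _ ≤ (4 * (1 / (1 + (c - a) ^ 2))) * (s - r) := by gcongr
    _ = _ := by ring

lemma sum_poissonWeight_succ_mul_exp_le (s : Finset ℕ) {x : ℝ} (hx : 0 < x) :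
    ∑ n ∈ s, poissonWeight (n + 1) x * Real.exp (poissonDev ((n + 1 : ℕ) : ℝ) x / 2) ≤
      4 * Real.pi := by
  obtain ⟨N, hN⟩ := s.exists_nat_subset_range
  calc _ ≤ ∑ n ∈ Finset.range N,
        poissonWeight (n + 1) x * Real.exp (poissonDev ((n + 1 : ℕ) : ℝ) x / 2) :=
        Finset.sum_le_sum_of_subset_of_nonneg hN fun n _ _ =>
          mul_nonneg (poissonWeight_nonneg _ hx.le) (Real.exp_pos _).le
    _ ≤ ∑ n ∈ Finset.range N,
        4 * (Real.arctan (√((n + 1 : ℕ) : ℝ) - √x) - Real.arctan (√(n : ℝ) - √x)) :=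
        Finset.sum_le_sum fun n _ => poissonWeight_succ_mul_exp_le_arctan_sub n hx
    _ ≤ _ := by
        rw [← Finset.mul_sum, Finset.sum_range_sub (fun n : ℕ => Real.arctan (√(n : ℝ) - √x))]
        have h : ∀ a b : ℝ, a < Real.pi / 2 → -(Real.pi / 2) < b → 4 * (a - b) ≤ 4 * Real.pi := by
          intro a b ha hb
          linarith
        exact h _ _ (Real.arctan_lt_pi_div_two _) (Real.neg_pi_div_two_lt_arctan _)

lemma poissonWeight_mul_exp_le_deriv_arctan {m : ℕ} (hm : 0 < m) {x : ℝ} (hx : 0 < x) :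
    poissonWeight m x * Real.exp (poissonDev m x / 2) ≤
      16 * (1 / (1 + (√x - √m) ^ 2) * (1 / (2 * √x))) := by
  refine (poissonWeight_mul_exp_poissonDev_half_le hm hx).trans ?_
  have hb : 1 ≤ √(m : ℝ) := Real.one_le_sqrt.2 (by exact_mod_cast hm)
  have ha : 0 < √x := Real.sqrt_pos.2 hx
  set b := √(m : ℝ)
  set a := √x
  have hexp := Real.quadratic_le_exp_of_nonneg (show 0 ≤ (b - a) ^ 2 / 2 by positivity)
  have h1 : (1 + (a - b) ^ 2) ^ 2 ≤ 8 * Real.exp ((b - a) ^ 2 / 2) := by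
    nlinarith [sq_nonneg (b - a)]
  have h2 : a ≤ b * (2 * (1 + (a - b) ^ 2)) := by
    nlinarith [sq_nonneg (a - b), sq_nonneg (a - b - 1),
      mul_nonneg (sub_nonneg.2 hb) (sq_nonneg (a - b))]
  have h3 : a * (1 + (a - b) ^ 2) ≤ 16 * b * Real.exp ((b - a) ^ 2 / 2) := by
    calc _ ≤ b * (2 * (1 + (a - b) ^ 2)) * (1 + (a - b) ^ 2) := by gcongr
      _ = 2 * b * (1 + (a - b) ^ 2) ^ 2 := by ring
      _ ≤ 2 * b * (8 * Real.exp ((b - a) ^ 2 / 2)) := by gcongr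
      _ = _ := by ring
  rw [neg_div, Real.exp_neg, inv_eq_one_div, div_div, one_div_mul_one_div, mul_one_div,
    div_le_div_iff₀ (by positivity) (by positivity)]
  linarith

lemma tendsto_arctan_sqrt_sub (b : ℝ) :
    Tendsto (fun x => Real.arctan (√x - b)) atTop (𝓝 (Real.pi / 2)) :=
  (Real.tendsto_arctan_atTop.mono_right nhdsWithin_le_nhds).comp
    (tendsto_atTop_add_const_right _ (-b) Real.tendsto_sqrt_atTop)

lemma hasDerivAt_arctan_sqrt_sub (b : ℝ) {x : ℝ} (hx : 0 < x) :
    HasDerivAt (fun x => Real.arctan (√x - b)) (1 / (1 + (√x - b) ^ 2) * (1 / (2 * √x))) x :=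
  ((Real.hasDerivAt_sqrt hx.ne').sub_const b).arctan

lemma integrableOn_deriv_arctan_sqrt_sub (b : ℝ) :
    IntegrableOn (fun x => 1 / (1 + (√x - b) ^ 2) * (1 / (2 * √x))) (Ioi 0) :=
  integrableOn_Ioi_deriv_of_nonneg (by fun_prop) (fun _ hx => hasDerivAt_arctan_sqrt_sub b hx)
    (fun x _ => by positivity) (tendsto_arctan_sqrt_sub b)

lemma integral_deriv_arctan_sqrt_sub_le (b : ℝ) :
    ∫ x in Ioi 0, 1 / (1 + (√x - b) ^ 2) * (1 / (2 * √x)) ≤ Real.pi := by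
  rw [integral_Ioi_of_hasDerivAt_of_nonneg (by fun_prop)
    (fun _ hx => hasDerivAt_arctan_sqrt_sub b hx) (fun x _ => by positivity)
    (tendsto_arctan_sqrt_sub b)]
  have := Real.neg_pi_div_two_lt_arctan (√0 - b)
  linarith

lemma add_mul_sub_le_of_monotone_deriv {h h' h'' : ℝ → ℝ} {a : ℝ}
    (h1 : ∀ s ∈ Ici a, HasDerivAt h (h' s) s) (h2 : ∀ s ∈ Ici a, HasDerivAt h' (h'' s) s)
    (hnn : ∀ s ∈ Ici a, 0 ≤ h'' s) {x y : ℝ} (hx : a ≤ x) (hy : a ≤ y) :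
    h x + (y - x) * h' x ≤ h y := by
  have hmono : MonotoneOn h' (Ici a) := by
    refine monotoneOn_of_deriv_nonneg (convex_Ici a)
      (fun s hs => (h2 s hs).continuousAt.continuousWithinAt)
      (fun s hs => (h2 s (interior_subset hs)).differentiableAt.differentiableWithinAt)
      fun s hs => ?_
    rw [(h2 s (interior_subset hs)).deriv]
    exact hnn s (interior_subset hs)
  rcases lt_trichotomy x y with hxy | rfl | hxy
  · obtain ⟨c, hc, hceq⟩ := exists_hasDerivAt_eq_slope h h' hxy
      (fun s hs => (h1 s (hx.trans hs.1)).continuousAt.continuousWithinAt)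
      (fun s hs => h1 s (hx.trans hs.1.le))
    rw [eq_div_iff (sub_pos.2 hxy).ne'] at hceq
    have := hmono hx (hx.trans hc.1.le) hc.1.le
    nlinarith
  · simp
  · obtain ⟨c, hc, hceq⟩ := exists_hasDerivAt_eq_slope h h' hxy
      (fun s hs => (h1 s (hy.trans hs.1)).continuousAt.continuousWithinAt)
      (fun s hs => h1 s (hy.trans hs.1.le))
    rw [eq_div_iff (sub_pos.2 hxy).ne'] at hceq
    have := hmono (hy.trans hc.1.le) hx hc.2.le
    nlinarith

lemma abs_taylorRem_le {φ φ' φ'' : ℝ → ℝ} {X ε : ℝ} (hX : 0 < X)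
    (hd1 : ∀ s ∈ Ici X, HasDerivAt φ (φ' s) s) (hd2 : ∀ s ∈ Ici X, HasDerivAt φ' (φ'' s) s)
    (hb : ∀ s ∈ Ici X, |s * φ'' s| ≤ ε) {x y : ℝ} (hx : X ≤ x) (hy : X ≤ y) :
    |taylorRem φ φ' y x| ≤ ε * poissonDev y x := by
  have hpos : ∀ s ∈ Ici X, 0 < s := fun s hs => hX.trans_le hs
  have key : ∀ σ : ℝ, |σ| = 1 → σ * taylorRem φ φ' y x ≤ ε * poissonDev y x := by
    intro σ hσ
    have h := add_mul_sub_le_of_monotone_deriv (a := X)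
      (h := fun s => ε * (s * Real.log s) - σ * φ s)
      (h' := fun s => ε * (Real.log s + 1) - σ * φ' s)
      (h'' := fun s => ε * s⁻¹ - σ * φ'' s)
      (fun s hs => ((Real.hasDerivAt_mul_log (hpos s hs).ne').const_mul ε).sub
        ((hd1 s hs).const_mul σ))
      (fun s hs => (((Real.hasDerivAt_log (hpos s hs).ne').add_const 1).const_mul ε).sub
        ((hd2 s hs).const_mul σ))
      (fun s hs => by
        have hs0 := hpos s hs
        have h1 : σ * (s * φ'' s) ≤ ε := by
          refine (le_abs_self _).trans ?_
          rw [abs_mul, hσ, one_mul]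
          exact hb s hs
        have : σ * φ'' s = σ * (s * φ'' s) * s⁻¹ := by field_simp
        rw [sub_nonneg, this]
        gcongr) hx hy
    have hl : Real.log (y / x) = Real.log y - Real.log x :=
      Real.log_div (hpos y hy).ne' (hpos x hx).ne'
    unfold taylorRem poissonDev
    rw [hl]
    linarith
  rw [abs_le]
  have h1 := key 1 (by simp)
  have h2 := key (-1) (by simp)
  constructor <;> linarith

lemma abs_exp_neg_sub_one_le {r D ε : ℝ} (hε : ε ≤ 1 / 2) (hε0 : 0 ≤ ε)
    (hr : |r| ≤ ε * D) : |Real.exp (-r) - 1| ≤ 2 * ε * Real.exp (D / 2) := by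
  have h1 : Real.exp (ε * D) ≤ 2 * ε * Real.exp (D / 2) + (1 - 2 * ε) := by
    have := convexOn_exp.2 (mem_univ (D / 2)) (mem_univ 0) (show 0 ≤ 2 * ε by linarith)
      (show 0 ≤ 1 - 2 * ε by linarith) (by ring)
    simp only [smul_eq_mul, mul_zero, add_zero, Real.exp_zero, mul_one] at this
    rwa [show 2 * ε * (D / 2) = ε * D by ring] at this
  have h2 : Real.exp (-r) ≤ Real.exp (ε * D) := Real.exp_le_exp.2 ((neg_le_abs r).trans hr)
  have h3 : 1 - Real.exp (-r) ≤ Real.exp (ε * D) - 1 := by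
    have h4 : -(ε * D) ≤ -r := by linarith [le_abs_self r]
    have := Real.exp_le_exp.2 h4
    have := Real.add_one_le_exp (ε * D)
    have := Real.add_one_le_exp (-(ε * D))
    have := Real.add_one_le_exp (-r)
    have := le_abs_self r
    linarith
  rw [abs_le]
  constructor <;> linarith

lemma integrableOn_poissonWeight (m : ℕ) : IntegrableOn (poissonWeight m) (Ioi 0) := by
  have h := (Real.GammaIntegral_convergent (s := m + 1) (by positivity)).div_const (m.factorial : ℝ)
  refine IntegrableOn.congr_fun h (fun x hx => ?_) measurableSet_Ioi
  simp only [poissonWeight, add_sub_cancel_right, Real.rpow_natCast]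
  ring

lemma integral_poissonWeight (m : ℕ) : ∫ x in Ioi 0, poissonWeight m x = 1 := by
  have h := Real.Gamma_nat_eq_factorial m
  rw [Real.Gamma_eq_integral (by positivity)] at h
  have h2 : ∫ x in Ioi 0, poissonWeight m x =
      ∫ x in Ioi 0, Real.exp (-x) * x ^ ((m : ℝ) + 1 - 1) / (m.factorial : ℝ) := by
    refine setIntegral_congr_fun measurableSet_Ioi fun x _ => ?_
    simp only [poissonWeight, add_sub_cancel_right, Real.rpow_natCast]
    ring
  rw [h2, integral_div, h, div_self (by positivity)]

lemma pow_div_factorial_mul_exp_eq (φ φ' : ℝ → ℝ) (n : ℕ) (x : ℝ) :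
    (x * Real.exp (φ' x)) ^ n / (n.factorial : ℝ) * Real.exp (-φ n) =
      poissonWeight n x * Real.exp (-taylorRem φ φ' n x) *
        Real.exp (x + x * φ' x - φ x) := by
  have : Real.exp (-x) * Real.exp (-taylorRem φ φ' n x) * Real.exp (x + x * φ' x - φ x) =
      Real.exp (φ' x) ^ n * Real.exp (-φ n) := by
    rw [← Real.exp_nat_mul, ← Real.exp_add, ← Real.exp_add, ← Real.exp_add, taylorRem]
    ring_nf
  calc _ = x ^ n / (n.factorial : ℝ) * (Real.exp (φ' x) ^ n * Real.exp (-φ n)) := by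
        rw [mul_pow]; ring
    _ = _ := by rw [← this, poissonWeight]; ring

lemma summable_poissonWeight_mul_exp_taylorRem (φ φ' : ℝ → ℝ)
    (hsum : ∀ t : ℝ, 0 ≤ t →
      Summable (fun n : ℕ => t ^ n / (n.factorial : ℝ) * Real.exp (-φ n)))
    {x : ℝ} (hx : 0 ≤ x) :
    Summable fun n : ℕ => poissonWeight n x * Real.exp (-taylorRem φ φ' n x) := by
  have h := hsum (x * Real.exp (φ' x)) (by positivity)
  simp only [pow_div_factorial_mul_exp_eq] at h
  exact (summable_mul_right_iff (Real.exp_ne_zero _)).1 h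

lemma hasSum_poissonWeight (x : ℝ) : HasSum (fun n : ℕ => poissonWeight n x) 1 := by
  have h := (NormedSpace.expSeries_div_hasSum_exp (𝔸 := ℝ) x).mul_right (Real.exp (-x))
  rwa [← Real.exp_eq_exp_ℝ, ← Real.exp_add, add_neg_cancel, Real.exp_zero] at h

lemma tendsto_poissonWeight_atTop (n : ℕ) : Tendsto (poissonWeight n) atTop (𝓝 0) := by
  have h := (Real.tendsto_pow_mul_exp_neg_atTop_nhds_zero n).div_const (n.factorial : ℝ)
  rw [zero_div] at h
  refine h.congr fun x => ?_
  rw [poissonWeight]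
  ring

lemma tendsto_poissonWeight_mul_exp_taylorRem {φ φ' φ'' : ℝ → ℝ} {x₀ : ℝ}
    (hd1 : ∀ x ∈ Ioi x₀, HasDerivAt φ (φ' x) x) (hd2 : ∀ x ∈ Ioi x₀, HasDerivAt φ' (φ'' x) x)
    (hl1 : Tendsto φ' atTop (𝓝 0)) (hl2 : Tendsto (fun x => x * φ'' x) atTop (𝓝 0)) (n : ℕ) :
    Tendsto (fun x => poissonWeight n x * Real.exp (-taylorRem φ φ' n x)) atTop (𝓝 0) := by
  have e2 : ∀ᶠ x in atTop, |x * φ'' x| ≤ 1 / 2 :=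
    hl2.abs.eventually_le_const (by norm_num)
  obtain ⟨X, hX⟩ := eventually_atTop.1 (e2.and (eventually_gt_atTop (max x₀ 0)))
  have hX0 : 0 < X := (le_max_right _ _).trans_lt (hX X le_rfl).2
  have hXx : ∀ s ∈ Ici X, s ∈ Ioi x₀ := fun s hs => (le_max_left _ _).trans_lt (hX s hs).2
  have hlim : Tendsto (fun x => (2 ^ n * Real.exp (φ X - φ n + n + X) / (n.factorial : ℝ)) *
      ((x / 2) ^ n * Real.exp (-(x / 2)))) atTop (𝓝 0) := by
    have := ((Real.tendsto_pow_mul_exp_neg_atTop_nhds_zero n).comp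
      (tendsto_id.atTop_div_const (show (0 : ℝ) < 2 by norm_num))).const_mul
      (2 ^ n * Real.exp (φ X - φ n + n + X) / (n.factorial : ℝ))
    simpa using this
  refine squeeze_zero' ?_ ?_ hlim
  · filter_upwards [eventually_ge_atTop 0] with x hx
    exact mul_nonneg (poissonWeight_nonneg _ hx) (Real.exp_pos _).le
  · filter_upwards [eventually_ge_atTop X,
      hl1.abs.eventually_le_const (show |(0 : ℝ)| < 1 by norm_num)] with x hx hφ'
    have hx0 : 0 < x := hX0.trans_le hx
    have h1 := abs_taylorRem_le hX0 (fun s hs => hd1 s (hXx s hs)) (fun s hs => hd2 s (hXx s hs))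
      (fun s hs => (hX s hs).1) hx le_rfl
    have hD : poissonDev X x ≤ x := by
      have : Real.log (X / x) ≤ 0 := Real.log_nonpos (by positivity) (by
        rw [div_le_one hx0]; exact hx)
      unfold poissonDev
      nlinarith
    have hn0 : (0 : ℝ) ≤ n := n.cast_nonneg
    have h2 : -taylorRem φ φ' n x ≤ φ X - φ n + n + X + x / 2 := by
      have h3 := (abs_le.1 h1).1
      have h4 := abs_le.1 hφ'
      unfold taylorRem at *
      nlinarith [mul_le_mul_of_nonneg_left h4.2 hn0, mul_le_mul_of_nonneg_left h4.1 hX0.le]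
    calc poissonWeight n x * Real.exp (-taylorRem φ φ' n x)
        ≤ poissonWeight n x * Real.exp (φ X - φ n + n + X + x / 2) := by
          gcongr
          exact poissonWeight_nonneg _ hx0.le
      _ = _ := by
          have : Real.exp (-x) * Real.exp (x / 2) = Real.exp (-(x / 2)) := by
            rw [← Real.exp_add]; ring_nf
          rw [Real.exp_add _ (x / 2), poissonWeight, ← this, div_pow]
          field_simp

lemma abs_tsum_le_of_sum_abs_le {f : ℕ → ℝ} {c : ℝ} (h : ∀ s : Finset ℕ, ∑ n ∈ s, |f n| ≤ c) :
    |∑' n, f n| ≤ c := by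
  simp only [← Real.norm_eq_abs] at h ⊢
  have hs : Summable fun n => ‖f n‖ := summable_of_sum_le (fun n => norm_nonneg (f n)) h
  exact (norm_tsum_le_tsum_norm hs).trans (hs.tsum_le_of_sum_le h)

lemma abs_tsum_poissonWeight_tail_le {φ φ' φ'' : ℝ → ℝ} {X ε : ℝ} (hX : 0 < X)
    (hd1 : ∀ s ∈ Ici X, HasDerivAt φ (φ' s) s) (hd2 : ∀ s ∈ Ici X, HasDerivAt φ' (φ'' s) s)
    (hb : ∀ s ∈ Ici X, |s * φ'' s| ≤ ε) (hε0 : 0 ≤ ε) (hε : ε ≤ 1 / 2) {x : ℝ} (hx : X ≤ x)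
    {k : ℕ} (hk : X ≤ k) :
    |∑' n : ℕ, poissonWeight (n + (k + 1)) x *
      (Real.exp (-taylorRem φ φ' ((n + (k + 1) : ℕ) : ℝ) x) - 1)| ≤ 8 * Real.pi * ε := by
  have hx0 : 0 < x := hX.trans_le hx
  have hpt : ∀ n : ℕ, |poissonWeight (n + (k + 1)) x *
      (Real.exp (-taylorRem φ φ' ((n + (k + 1) : ℕ) : ℝ) x) - 1)| ≤
      2 * ε * (poissonWeight ((n + k) + 1) x *
        Real.exp (poissonDev (((n + k) + 1 : ℕ) : ℝ) x / 2)) := by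
    intro n
    have hp := poissonWeight_nonneg (n + (k + 1)) hx0.le
    have hn : X ≤ ((n + (k + 1) : ℕ) : ℝ) := by
      push_cast
      have : (0 : ℝ) ≤ n := n.cast_nonneg
      linarith
    have h := abs_exp_neg_sub_one_le hε hε0 (abs_taylorRem_le hX hd1 hd2 hb hx hn)
    rw [abs_mul, abs_of_nonneg hp]
    calc _ ≤ poissonWeight (n + (k + 1)) x *
          (2 * ε * Real.exp (poissonDev ((n + (k + 1) : ℕ) : ℝ) x / 2)) := by gcongr
      _ = _ := by rw [← add_assoc]; ring
  have hsum : ∀ s : Finset ℕ, ∑ n ∈ s, |poissonWeight (n + (k + 1)) x *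
      (Real.exp (-taylorRem φ φ' ((n + (k + 1) : ℕ) : ℝ) x) - 1)| ≤ 8 * Real.pi * ε := by
    intro s
    have h := sum_poissonWeight_succ_mul_exp_le (s.map (addRightEmbedding k)) hx0
    rw [Finset.sum_map] at h
    calc _ ≤ ∑ n ∈ s, 2 * ε * (poissonWeight ((n + k) + 1) x *
          Real.exp (poissonDev (((n + k) + 1 : ℕ) : ℝ) x / 2)) := Finset.sum_le_sum fun n _ => hpt n
      _ ≤ 2 * ε * (4 * Real.pi) := by
          rw [← Finset.mul_sum]
          gcongr
          exact h
      _ = _ := by ring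
  exact abs_tsum_le_of_sum_abs_le hsum

lemma tendsto_tsum_poissonWeight_mul_exp_taylorRem {φ φ' φ'' : ℝ → ℝ} {x₀ : ℝ}
    (hd1 : ∀ x ∈ Ioi x₀, HasDerivAt φ (φ' x) x) (hd2 : ∀ x ∈ Ioi x₀, HasDerivAt φ' (φ'' x) x)
    (hl1 : Tendsto φ' atTop (𝓝 0)) (hl2 : Tendsto (fun x => x * φ'' x) atTop (𝓝 0))
    (hsum : ∀ t : ℝ, 0 ≤ t →
      Summable (fun n : ℕ => t ^ n / (n.factorial : ℝ) * Real.exp (-φ n))) :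
    Tendsto (fun x => ∑' n : ℕ, poissonWeight n x * Real.exp (-taylorRem φ φ' n x))
      atTop (𝓝 1) := by
  rw [Metric.tendsto_nhds]
  intro η hη
  have hpi := Real.pi_pos
  obtain ⟨ε, hε0, hε, hεη⟩ : ∃ ε : ℝ, 0 < ε ∧ ε ≤ 1 / 2 ∧ 8 * Real.pi * ε ≤ η / 2 := by
    refine ⟨min (1 / 2) (η / (16 * Real.pi)), by positivity, min_le_left _ _, ?_⟩
    calc _ ≤ 8 * Real.pi * (η / (16 * Real.pi)) := by gcongr; exact min_le_right _ _
      _ = _ := by field_simp; norm_num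
  have e2 : ∀ᶠ x in atTop, |x * φ'' x| ≤ ε := hl2.abs.eventually_le_const (by simpa using hε0)
  obtain ⟨X, hX⟩ := eventually_atTop.1 (e2.and (eventually_gt_atTop (max x₀ 0)))
  have hX0 : 0 < X := (le_max_right _ _).trans_lt (hX X le_rfl).2
  have hXx : ∀ s ∈ Ici X, s ∈ Ioi x₀ := fun s hs => (le_max_left _ _).trans_lt (hX s hs).2
  obtain ⟨k, hk⟩ := exists_nat_ge X
  have hhead : Tendsto (fun x => ∑ n ∈ Finset.range (k + 1), poissonWeight n x *
      (Real.exp (-taylorRem φ φ' n x) - 1)) atTop (𝓝 0) := by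
    rw [← Finset.sum_const_zero (s := Finset.range (k + 1))]
    refine tendsto_finsetSum _ fun n _ => ?_
    have := (tendsto_poissonWeight_mul_exp_taylorRem hd1 hd2 hl1 hl2 n).sub
      (tendsto_poissonWeight_atTop n)
    rw [sub_zero] at this
    exact this.congr fun x => by ring
  filter_upwards [eventually_ge_atTop X, (Metric.tendsto_nhds.1 hhead) (η / 2) (by positivity)]
    with x hx hxhead
  have hs1 := summable_poissonWeight_mul_exp_taylorRem φ φ' hsum (hX0.trans_le hx).le
  have hs2 := hasSum_poissonWeight x
  have htail := abs_tsum_poissonWeight_tail_le hX0 (fun s hs => hd1 s (hXx s hs))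
    (fun s hs => hd2 s (hXx s hs)) (fun s hs => (hX s hs).1) hε0.le hε hx hk
  have hsplit : (∑' n : ℕ, poissonWeight n x * Real.exp (-taylorRem φ φ' n x)) - 1 =
      ∑' n : ℕ, poissonWeight n x * (Real.exp (-taylorRem φ φ' n x) - 1) := by
    have h := hs1.tsum_sub hs2.summable
    rw [hs2.tsum_eq] at h
    simp only [← h, mul_sub, mul_one]
  have hs3 : Summable fun n : ℕ => poissonWeight n x * (Real.exp (-taylorRem φ φ' n x) - 1) := by
    simpa only [mul_sub, mul_one] using hs1.sub hs2.summable
  rw [Real.dist_eq, hsplit, ← hs3.sum_add_tsum_nat_add (k + 1)]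
  rw [Real.dist_eq, sub_zero] at hxhead
  refine (abs_add_le _ _).trans_lt ?_
  linarith

lemma tendsto_mul_exp_atTop {f : ℝ → ℝ} (hf : Tendsto f atTop (𝓝 0)) :
    Tendsto (fun x => x * Real.exp (f x)) atTop atTop :=
  tendsto_id.atTop_mul_pos (by simp) ((Real.continuous_exp.tendsto 0).comp hf)

lemma hasDerivAt_mul_exp {f : ℝ → ℝ} {f' x : ℝ} (hf : HasDerivAt f f' x) :
    HasDerivAt (fun x => x * Real.exp (f x)) (Real.exp (f x) * (1 + x * f')) x :=
  ((hasDerivAt_id' x).mul hf.exp).congr_deriv (by ring)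

lemma monotoneOn_image_mul_exp {f f' : ℝ → ℝ} {X : ℝ} (hd : ∀ s ∈ Ici X, HasDerivAt f (f' s) s)
    (hpos : ∀ s ∈ Ici X, 0 < 1 + s * f' s) (hf : Tendsto f atTop (𝓝 0)) :
    MonotoneOn (fun x => x * Real.exp (f x)) (Ioi X) ∧
      (fun x => x * Real.exp (f x)) '' Ioi X = Ioi (X * Real.exp (f X)) := by
  have hcont : ContinuousOn (fun x => x * Real.exp (f x)) (Ici X) := fun s hs =>
    (hasDerivAt_mul_exp (hd s hs)).continuousAt.continuousWithinAt
  have hmono : StrictMonoOn (fun x => x * Real.exp (f x)) (Ici X) := by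
    refine strictMonoOn_of_deriv_pos (convex_Ici X) hcont fun s hs => ?_
    rw [(hasDerivAt_mul_exp (hd s (interior_subset hs))).deriv]
    exact mul_pos (Real.exp_pos _) (hpos s (interior_subset hs))
  refine ⟨hmono.monotoneOn.mono Ioi_subset_Ici_self, Subset.antisymm ?_ ?_⟩
  · rintro _ ⟨x, hx, rfl⟩
    exact hmono self_mem_Ici (Ioi_subset_Ici_self hx) hx
  · intro t ht
    obtain ⟨b, hbt, hb⟩ := (((tendsto_mul_exp_atTop hf).eventually_gt_atTop t).and
      (eventually_gt_atTop X)).exists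
    obtain ⟨x, hx, hxt⟩ := intermediate_value_Ioo hb.le (hcont.mono Icc_subset_Ici_self) ⟨ht, hbt⟩
    exact ⟨x, hx.1, hxt⟩

lemma tendsto_setIntegral_Ioc_poissonWeight {X : ℝ} (hX : 0 ≤ X) :
    Tendsto (fun m : ℕ => ∫ x in Ioc 0 X, poissonWeight m x) atTop (𝓝 0) := by
  have h := (FloorSemiring.tendsto_pow_div_factorial_atTop X).mul_const X
  rw [zero_mul] at h
  refine squeeze_zero_norm (fun m => ?_) h
  refine (norm_setIntegral_le_of_norm_le_const (C := X ^ m / (m.factorial : ℝ)) (by simp)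
    fun x hx => ?_).trans_eq (by simp [hX])
  rw [Real.norm_of_nonneg (poissonWeight_nonneg m hx.1.le), poissonWeight]
  have hx0 := hx.1.le
  calc _ ≤ X ^ m / (m.factorial : ℝ) * 1 := by
        gcongr
        · exact hx.2
        · exact Real.exp_le_one_iff.2 (by linarith)
    _ = _ := mul_one _

lemma tendsto_setIntegral_Ioc_div_tsum {ξ : ℕ → ℝ} (hξ : ∀ n, 0 ≤ ξ n) (hξ0 : ξ 0 = 1)
    (hsum : ∀ t : ℝ, 0 ≤ t → Summable (fun n : ℕ => t ^ n / (n.factorial : ℝ) * ξ n))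
    {T : ℝ} (hT : 0 ≤ T) :
    Tendsto (fun m : ℕ => ∫ t in Ioc 0 T, (t ^ m / (m.factorial : ℝ) * ξ m) /
      ∑' n : ℕ, t ^ n / (n.factorial : ℝ) * ξ n) atTop (𝓝 0) := by
  have h := (hsum T hT).tendsto_atTop_zero.mul_const T
  rw [zero_mul] at h
  refine squeeze_zero_norm (fun m => ?_) h
  refine (norm_setIntegral_le_of_norm_le_const (C := T ^ m / (m.factorial : ℝ) * ξ m) (by simp)
    fun t ht => ?_).trans_eq (by simp [hT])
  have ht0 := ht.1.le
  have hnn : ∀ n : ℕ, 0 ≤ t ^ n / (n.factorial : ℝ) * ξ n := fun n =>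
    mul_nonneg (by positivity) (hξ n)
  have h1 : 1 ≤ ∑' n : ℕ, t ^ n / (n.factorial : ℝ) * ξ n := by
    have := (hsum t ht0).le_tsum 0 fun n _ => hnn n
    simpa [hξ0] using this
  rw [Real.norm_of_nonneg (div_nonneg (hnn m) (zero_le_one.trans h1))]
  refine (div_le_self (hnn m) h1).trans ?_
  have := hξ m
  gcongr
  exact ht.2

lemma abs_setIntegral_Ioi_poissonWeight_mul_sub_le {φ φ' φ'' g : ℝ → ℝ} {X ε : ℝ} (hX : 0 < X)
    (hd1 : ∀ s ∈ Ici X, HasDerivAt φ (φ' s) s) (hd2 : ∀ s ∈ Ici X, HasDerivAt φ' (φ'' s) s)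
    (hb : ∀ s ∈ Ici X, |s * φ'' s| ≤ ε) (hg : ∀ s ∈ Ici X, |g s - 1| ≤ ε)
    (hε0 : 0 ≤ ε) (hε : ε ≤ 1 / 2) {m : ℕ} (hm : X ≤ m)
    (hint : IntegrableOn (fun x => poissonWeight m x * (Real.exp (-taylorRem φ φ' m x) * g x))
      (Ioi X)) :
    |(∫ x in Ioi X, poissonWeight m x * (Real.exp (-taylorRem φ φ' m x) * g x)) -
      ∫ x in Ioi X, poissonWeight m x| ≤ (64 * Real.pi + 1) * ε := by
  have hm0 : 0 < m := by exact_mod_cast hX.trans_le hm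
  have hXsub : Ioi X ⊆ Ioi 0 := Ioi_subset_Ioi hX.le
  have hw := integrableOn_poissonWeight m
  have hk := (integrableOn_deriv_arctan_sqrt_sub √(m : ℝ)).const_mul (64 * ε)
  have hw' := hw.const_mul ε
  rw [← integral_sub hint (hw.mono_set hXsub), ← Real.norm_eq_abs]
  have hsum : IntegrableOn (fun x => 64 * ε * (1 / (1 + (√x - √m) ^ 2) * (1 / (2 * √x))) +
      ε * poissonWeight m x) (Ioi 0) := hk.add hw'
  have hnn : ∀ x ∈ Ioi (0 : ℝ), 0 ≤ 64 * ε * (1 / (1 + (√x - √m) ^ 2) * (1 / (2 * √x))) +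
      ε * poissonWeight m x := fun x hx =>
    add_nonneg (by positivity) (mul_nonneg hε0 (poissonWeight_nonneg m (le_of_lt hx)))
  calc _ ≤ ∫ x in Ioi X, (64 * ε * (1 / (1 + (√x - √m) ^ 2) * (1 / (2 * √x))) +
        ε * poissonWeight m x) := by
        refine norm_integral_le_of_norm_le (hsum.mono_set hXsub) ?_
        refine (ae_restrict_mem measurableSet_Ioi).mono fun x hx => ?_
        have hx0 : 0 < x := hXsub hx
        have hp := poissonWeight_nonneg m hx0.le
        have h1 := abs_exp_neg_sub_one_le hε hε0 (abs_taylorRem_le hX hd1 hd2 hb (le_of_lt hx) hm)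
        have h2 := hg x (Ioi_subset_Ici_self hx)
        have h3 : |g x| ≤ 2 := by
          rw [abs_le] at h2 ⊢
          constructor <;> linarith
        have h4 := poissonWeight_mul_exp_le_deriv_arctan hm0 hx0
        set e := Real.exp (-taylorRem φ φ' m x)
        have h5 : |e * g x - 1| ≤ 2 * ε * Real.exp (poissonDev m x / 2) * 2 + ε := by
          calc |e * g x - 1| = |(e - 1) * g x + (g x - 1)| := by ring_nf
            _ ≤ |e - 1| * |g x| + |g x - 1| := by
              rw [← abs_mul]; exact abs_add_le _ _
            _ ≤ _ := by gcongr
        calc ‖poissonWeight m x * (e * g x) - poissonWeight m x‖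
            = poissonWeight m x * |e * g x - 1| := by
              rw [Real.norm_eq_abs, ← mul_sub_one, abs_mul, abs_of_nonneg hp]
          _ ≤ poissonWeight m x * (2 * ε * Real.exp (poissonDev m x / 2) * 2 + ε) := by gcongr
          _ = 4 * ε * (poissonWeight m x * Real.exp (poissonDev m x / 2)) +
              ε * poissonWeight m x := by ring
          _ ≤ 4 * ε * (16 * (1 / (1 + (√x - √m) ^ 2) * (1 / (2 * √x)))) +
              ε * poissonWeight m x := by gcongr
          _ = _ := by ring
    _ ≤ ∫ x in Ioi 0, (64 * ε * (1 / (1 + (√x - √m) ^ 2) * (1 / (2 * √x))) +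
        ε * poissonWeight m x) :=
        setIntegral_mono_set hsum ((ae_restrict_mem measurableSet_Ioi).mono hnn)
          hXsub.eventuallyLE
    _ = 64 * ε * (∫ x in Ioi 0, 1 / (1 + (√x - √m) ^ 2) * (1 / (2 * √x))) + ε * 1 := by
        rw [integral_add hk hw', integral_const_mul, integral_const_mul, integral_poissonWeight]
    _ ≤ 64 * ε * Real.pi + ε * 1 := by
        gcongr
        exact integral_deriv_arctan_sqrt_sub_le _
    _ = _ := by ring

/-- asymptotic Poisson–Gamma duality: let `φ : [0,∞) → ℝ` be
three times differentiable on `(x₀, ∞)`, `φ(0) = 0`, with `φ′(x) → 0`,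
`x φ″(x) → 0`, `x² φ‴(x) → 0` as `x → ∞`. Set `ξ(x) = e^{−φ(x)}` and suppose
`A(t) = Σₙ (tⁿ/n!) ξ(n)` converges for all `t ≥ 0` and the integrals below are
finite. Then
`I_m = ∫₀^∞ ((t^m/m!) ξ(m)) / (Σₙ (tⁿ/n!) ξ(n)) dt → 1` as `m → ∞`. -/
theorem stmt_15 (φ φ' φ'' φ''' : ℝ → ℝ) (x₀ : ℝ) (hx₀ : 0 ≤ x₀)
    (hφ0 : φ 0 = 0)
    (hd1 : ∀ x ∈ Set.Ioi x₀, HasDerivAt φ (φ' x) x)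
    (hd2 : ∀ x ∈ Set.Ioi x₀, HasDerivAt φ' (φ'' x) x)
    (hd3 : ∀ x ∈ Set.Ioi x₀, HasDerivAt φ'' (φ''' x) x)
    (hl1 : Filter.Tendsto φ' Filter.atTop (nhds 0))
    (hl2 : Filter.Tendsto (fun x => x * φ'' x) Filter.atTop (nhds 0))
    (hl3 : Filter.Tendsto (fun x => x ^ 2 * φ''' x) Filter.atTop (nhds 0))
    (hsum : ∀ t : ℝ, 0 ≤ t →
      Summable (fun n : ℕ => t ^ n / (n.factorial : ℝ) * Real.exp (-φ n)))
    (hint : ∀ m : ℕ, IntegrableOn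
      (fun t => (t ^ m / (m.factorial : ℝ) * Real.exp (-φ m)) /
        ∑' n : ℕ, t ^ n / (n.factorial : ℝ) * Real.exp (-φ n)) (Set.Ioi 0)) :
    Filter.Tendsto
      (fun m : ℕ => ∫ t in Set.Ioi (0 : ℝ),
        (t ^ m / (m.factorial : ℝ) * Real.exp (-φ m)) /
          ∑' n : ℕ, t ^ n / (n.factorial : ℝ) * Real.exp (-φ n))
      Filter.atTop (nhds 1) := by
  set A : ℝ → ℝ := fun t => ∑' n : ℕ, t ^ n / (n.factorial : ℝ) * Real.exp (-φ n) with hA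
  set B : ℝ → ℝ := fun x => ∑' n : ℕ, poissonWeight n x * Real.exp (-taylorRem φ φ' n x) with hB
  set g : ℝ → ℝ := fun x => Real.exp (φ' x) * (1 + x * φ'' x) / B x with hgdef
  set F : ℕ → ℝ → ℝ := fun m t => (t ^ m / (m.factorial : ℝ) * Real.exp (-φ m)) / A t with hF
  have hBlim : Tendsto B atTop (𝓝 1) :=
    tendsto_tsum_poissonWeight_mul_exp_taylorRem hd1 hd2 hl1 hl2 hsum
  have hglim : Tendsto g atTop (𝓝 1) := by
    have h := (((Real.continuous_exp.tendsto 0).comp hl1).mul (hl2.const_add 1)).div hBlim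
      one_ne_zero
    simp only [Real.exp_zero, add_zero, mul_one, div_one] at h
    exact h
  have hFcomp : ∀ (m : ℕ) (x : ℝ), Real.exp (φ' x) * (1 + x * φ'' x) *
      F m (x * Real.exp (φ' x)) =
      poissonWeight m x * (Real.exp (-taylorRem φ φ' m x) * g x) := by
    intro m x
    simp only [hF, hA, hgdef, hB, pow_div_factorial_mul_exp_eq, tsum_mul_right]
    rw [mul_div_mul_right _ _ (Real.exp_ne_zero _)]
    ring
  have hpi := Real.pi_pos
  rw [Metric.tendsto_nhds]
  intro η hη
  obtain ⟨ε, hε0, hε, hεη⟩ : ∃ ε : ℝ, 0 < ε ∧ ε ≤ 1 / 2 ∧ (64 * Real.pi + 1) * ε ≤ η / 2 := by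
    refine ⟨min (1 / 2) (η / (2 * (64 * Real.pi + 1))), by positivity, min_le_left _ _, ?_⟩
    calc _ ≤ (64 * Real.pi + 1) * (η / (2 * (64 * Real.pi + 1))) := by
          gcongr; exact min_le_right _ _
      _ = _ := by field_simp
  have e1 : ∀ᶠ x in atTop, |x * φ'' x| ≤ ε := hl2.abs.eventually_le_const (by simpa using hε0)
  have e2 : ∀ᶠ x in atTop, |g x - 1| ≤ ε :=
    (hglim.sub_const 1).abs.eventually_le_const (by simpa using hε0)
  obtain ⟨X, hX⟩ := eventually_atTop.1 ((e1.and e2).and (eventually_gt_atTop x₀))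
  have hX0 : 0 < X := hx₀.trans_lt (hX X le_rfl).2
  have hd1' : ∀ s ∈ Ici X, HasDerivAt φ (φ' s) s := fun s hs => hd1 s (hX s hs).2
  have hd2' : ∀ s ∈ Ici X, HasDerivAt φ' (φ'' s) s := fun s hs => hd2 s (hX s hs).2
  have hb : ∀ s ∈ Ici X, |s * φ'' s| ≤ ε := fun s hs => (hX s hs).1.1
  have hg : ∀ s ∈ Ici X, |g s - 1| ≤ ε := fun s hs => (hX s hs).1.2
  obtain ⟨hmono, himage⟩ := monotoneOn_image_mul_exp hd2'
    (fun s hs => by linarith [(abs_le.1 (hb s hs)).1]) hl1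
  have hderiv : ∀ x ∈ Ioi X, HasDerivWithinAt (fun x => x * Real.exp (φ' x))
      (Real.exp (φ' x) * (1 + x * φ'' x)) (Ioi X) x := fun x hx =>
    (hasDerivAt_mul_exp (hd2' x (Ioi_subset_Ici_self hx))).hasDerivWithinAt
  set T := X * Real.exp (φ' X) with hT
  have hT0 : 0 < T := by positivity
  have hFtail : ∀ m, ∫ t in Ioi T, F m t =
      ∫ x in Ioi X, poissonWeight m x * (Real.exp (-taylorRem φ φ' m x) * g x) := by
    intro m
    rw [← himage, integral_image_eq_integral_deriv_smul_of_monotoneOn measurableSet_Ioi hderiv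
      hmono]
    simp only [smul_eq_mul, hFcomp]
  have hGint : ∀ m, IntegrableOn
      (fun x => poissonWeight m x * (Real.exp (-taylorRem φ φ' m x) * g x)) (Ioi X) := by
    intro m
    have h := (integrableOn_image_iff_integrableOn_deriv_smul_of_monotoneOn measurableSet_Ioi
      hderiv hmono (F m)).1 (himage ▸ (hint m).mono_set (Ioi_subset_Ioi hT0.le))
    simpa only [smul_eq_mul, hFcomp] using h
  have hsplit : ∀ (f : ℝ → ℝ) (a : ℝ), 0 ≤ a → IntegrableOn f (Ioi 0) →
      ∫ t in Ioi 0, f t = (∫ t in Ioc 0 a, f t) + ∫ t in Ioi a, f t := by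
    intro f a ha hf
    rw [← Ioc_union_Ioi_eq_Ioi ha, setIntegral_union (Ioc_disjoint_Ioi le_rfl) measurableSet_Ioi
      (hf.mono_set Ioc_subset_Ioi_self) (hf.mono_set (Ioi_subset_Ioi ha))]
  have hhead : Tendsto (fun m : ℕ => (∫ t in Ioc 0 T, F m t) -
      ∫ x in Ioc 0 X, poissonWeight m x) atTop (𝓝 0) := by
    simpa using (tendsto_setIntegral_Ioc_div_tsum (fun n => (Real.exp_pos (-φ n)).le)
      (by simp [hφ0]) hsum hT0.le).sub (tendsto_setIntegral_Ioc_poissonWeight hX0.le)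
  filter_upwards [(Metric.tendsto_nhds.1 hhead) (η / 2) (by positivity),
    tendsto_natCast_atTop_atTop.eventually_ge_atTop X] with m hm hXm
  have h1 := hsplit (F m) T hT0.le (hint m)
  have h2 := hsplit (poissonWeight m) X hX0.le (integrableOn_poissonWeight m)
  rw [integral_poissonWeight] at h2
  have h3 := abs_setIntegral_Ioi_poissonWeight_mul_sub_le hX0 hd1' hd2' hb hg hε0.le hε hXm
    (hGint m)
  rw [Real.dist_eq, sub_zero] at hm
  rw [Real.dist_eq, h1, h2, hFtail, add_sub_add_comm]
  refine (abs_add_le _ _).trans_lt ?_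
  linarith
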